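/- Let N ≥ 1 be an integer, let R > 0, and let Ω ⊆ ℝ^N be an open set whose Lebesgue measure equals the Lebesgue measure of a ball of radius R. Then for every infinitely differentiable function v : ℝ^N → ℝ with compact support contained in Ω, one has (1/2)∫_{ℝ^N} (Δv)² dx − ∫_{ℝ^N} v dx ≥ − ω_{N−1} R^{N+4} / (2 N² (N+2)² (N+4)). -/

import Mathlib

open MeasureTheory Real

/-- The Laplacian of `f : ℝ^N → ℝ`: the sum of the second partial derivatives
`∑ i, ∂²f/∂xᵢ²` (the trace of the Hessian). -/
noncomputable def laplacian {N : ℕ} (f : EuclideanSpace ℝ (Fin N) → ℝ)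
    (x : EuclideanSpace ℝ (Fin N)) : ℝ :=
  ∑ i : Fin N, fderiv ℝ (fun y => fderiv ℝ f y (EuclideanSpace.single i 1)) x
    (EuclideanSpace.single i 1)

open scoped ENNReal NNReal Pointwise

theorem bm1_compact {A B C : Set ℝ} (hA : IsCompact A) (hB : IsCompact B) (hAn : A.Nonempty)
    (hBn : B.Nonempty) (h : ∀ x ∈ A, ∀ y ∈ B, x + y ∈ C) :
    volume A + volume B ≤ volume C := by
  have h1 := hA.sSup_mem hAn
  have h2 := hB.sInf_mem hBn
  set α := sSup A
  set β := sInf B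
  have e1 : volume ((fun x => x + β) '' A) = volume A := by
    rw [Set.image_add_right, measure_preimage_add_right]
  have e2 : volume ((fun x => α + x) '' B) = volume B := by
    rw [Set.image_add_left, measure_preimage_add]
  rw [← e1, ← e2, ← measure_union₀]
  · apply measure_mono
    rintro z (⟨x, hx, rfl⟩ | ⟨x, hx, rfl⟩)
    · exact h _ hx _ h2
    · exact h _ h1 _ hx
  · exact (hB.image (by fun_prop)).measurableSet.nullMeasurableSet
  · refine measure_mono_null (t := {α + β}) ?_ (by simp)
    rintro z ⟨⟨x, hx, rfl⟩, ⟨y, hy, hxy⟩⟩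
    have := le_csSup hA.bddAbove hx
    have := csInf_le hB.bddBelow hy
    simp only at hxy ⊢
    have : x + β = α + β := by change x ≤ α at *; change β ≤ y at *; linarith
    exact this

theorem bm1 {A B C : Set ℝ} (hA : MeasurableSet A) (hB : MeasurableSet B) (hAn : A.Nonempty)
    (hBn : B.Nonempty) (h : ∀ x ∈ A, ∀ y ∈ B, x + y ∈ C) :
    volume A + volume B ≤ volume C := by
  obtain ⟨x0, hx0⟩ := hAn
  obtain ⟨y0, hy0⟩ := hBn
  rw [hA.measure_eq_iSup_isCompact, hB.measure_eq_iSup_isCompact]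
  have key : ∀ K ⊆ A, IsCompact K → ∀ L ⊆ B, IsCompact L → volume K + volume L ≤ volume C := by
    intro K hK hKc L hL hLc
    refine le_trans (add_le_add (measure_mono (Set.subset_insert x0 K))
      (measure_mono (Set.subset_insert y0 L))) ?_
    exact bm1_compact (hKc.insert x0) (hLc.insert y0) ⟨x0, by simp⟩ ⟨y0, by simp⟩
      (fun x hx y hy => h x ((Set.insert_subset hx0 hK) hx) y ((Set.insert_subset hy0 hL) hy))
  simp only [iSup_and']
  exact ENNReal.biSup_add_biSup_le' ⟨∅, by simp⟩ ⟨∅, by simp⟩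
    (fun K hK L hL => key K hK.1 hK.2 L hL.1 hL.2)

/-- normalized one-dimensional case -/
theorem pl1_norm {a b : ℝ} (ha : 0 < a) (hb : 0 < b) (f g h : ℝ → ℝ)
    (hf : Measurable f) (hg : Measurable g) (hh : Measurable h)
    (hf0 : ∀ x, 0 ≤ f x) (hg0 : ∀ x, 0 ≤ g x) (hh0 : ∀ x, 0 ≤ h x)
    (hf1 : ∀ x, f x ≤ 1) (hg1 : ∀ x, g x ≤ 1)
    (hfs : ∀ t < 1, ∃ x, t < f x) (hgs : ∀ t < 1, ∃ x, t < g x)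
    (H : ∀ x y, min (f x) (g y) ≤ h (a * x + b * y)) :
    ENNReal.ofReal a * (∫⁻ x, ENNReal.ofReal (f x)) + ENNReal.ofReal b * (∫⁻ x, ENNReal.ofReal (g x))
      ≤ ∫⁻ x, ENNReal.ofReal (h x) := by
  rw [lintegral_eq_lintegral_meas_lt _ (.of_forall hf0) hf.aemeasurable,
    lintegral_eq_lintegral_meas_lt _ (.of_forall hg0) hg.aemeasurable,
    lintegral_eq_lintegral_meas_lt _ (.of_forall hh0) hh.aemeasurable]
  have mf : Measurable fun t => volume {x | t < f x} :=
    Antitone.measurable (fun s t hst => measure_mono (fun x hx => lt_of_le_of_lt hst hx))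
  have mg : Measurable fun t => volume {x | t < g x} :=
    Antitone.measurable (fun s t hst => measure_mono (fun x hx => lt_of_le_of_lt hst hx))
  rw [← lintegral_const_mul _ mf, ← lintegral_const_mul _ mg, ← lintegral_add_left (by fun_prop)]
  refine lintegral_mono (fun t => ?_)
  rcases lt_or_ge t 1 with ht | ht
  · have e1 : volume (a • {x | t < f x}) = ENNReal.ofReal a * volume {x | t < f x} := by
      rw [Measure.addHaar_smul]; simp [abs_of_pos ha]
    have e2 : volume (b • {x | t < g x}) = ENNReal.ofReal b * volume {x | t < g x} := by
      rw [Measure.addHaar_smul]; simp [abs_of_pos hb]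
    rw [← e1, ← e2]
    refine bm1 ((measurableSet_lt measurable_const hf).const_smul₀ a)
      ((measurableSet_lt measurable_const hg).const_smul₀ b)
      (Set.Nonempty.smul_set (hfs t ht)) (Set.Nonempty.smul_set (hgs t ht)) ?_
    rintro _ ⟨x, hx, rfl⟩ _ ⟨y, hy, rfl⟩
    exact lt_of_lt_of_le (lt_min hx hy) (H x y)
  · have : {x | t < f x} = ∅ := by ext x; simpa using (hf1 x).trans ht
    have h2 : {x | t < g x} = ∅ := by ext x; simpa using (hg1 x).trans ht
    simp [this, h2]

def PL (E : Type*) [AddCommGroup E] [Module ℝ E] [MeasureSpace E] : Prop :=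
  ∀ a b : ℝ, 0 < a → 0 < b → a + b = 1 → ∀ f g h : E → ℝ≥0∞, Measurable f → Measurable g →
    Measurable h → (∀ x y, f x ^ a * g y ^ b ≤ h (a • x + b • y)) →
    (∫⁻ x, f x) ^ a * (∫⁻ x, g x) ^ b ≤ ∫⁻ x, h x

theorem pl_prod {E F : Type*} [AddCommGroup E] [Module ℝ E] [MeasureSpace E]
    [AddCommGroup F] [Module ℝ F] [MeasureSpace F] [SFinite (volume : Measure F)]
    [SFinite (volume : Measure E)]
    (hE : PL E) (hF : PL F) : PL (E × F) := by
  intro a b ha hb hab f g h hf hg hh H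
  rw [Measure.volume_eq_prod, lintegral_prod _ hf.aemeasurable, lintegral_prod _ hg.aemeasurable,
    lintegral_prod _ hh.aemeasurable]
  refine hE a b ha hb hab _ _ _ hf.lintegral_prod_right' hg.lintegral_prod_right'
    hh.lintegral_prod_right' (fun x y => ?_)
  exact hF a b ha hb hab _ _ _ (by fun_prop) (by fun_prop) (by fun_prop) (fun x₂ y₂ => H (x, x₂) (y, y₂))

theorem pl_transfer {E F : Type*} [AddCommGroup E] [Module ℝ E] [MeasureSpace E]
    [AddCommGroup F] [Module ℝ F] [MeasureSpace F] (e : E ≃ᵐ F) (he : MeasurePreserving e)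
    (hl : ∀ (a b : ℝ) x y, e.symm (a • x + b • y) = a • e.symm x + b • e.symm y)
    (hE : PL E) : PL F := by
  intro a b ha hb hab f g h hf hg hh H
  rw [← he.lintegral_comp hf, ← he.lintegral_comp hg, ← he.lintegral_comp hh]
  refine hE a b ha hb hab _ _ _ (by fun_prop) (by fun_prop) (by fun_prop) (fun x y => ?_)
  have := H (e x) (e y)
  have h2 := hl a b (e x) (e y)
  simp only [MeasurableEquiv.symm_apply_apply] at h2
  rw [← h2]; simpa using this

theorem pl_bdd {a b : ℝ} (ha : 0 < a) (hb : 0 < b) (hab : a + b = 1) (f g h : ℝ → ℝ≥0∞)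
    (hf : Measurable f) (hg : Measurable g) (hh : Measurable h)
    (H : ∀ x y, f x ^ a * g y ^ b ≤ h (a • x + b • y)) (hfb : ⨆ x, f x ≠ ∞) (hgb : ⨆ x, g x ≠ ∞) :
    (∫⁻ x, f x) ^ a * (∫⁻ x, g x) ^ b ≤ ∫⁻ x, h x := by
  set A := ⨆ x, f x with hA
  set B := ⨆ x, g x with hB
  have hfA : ∀ x, f x ≤ A := le_iSup f
  have hgB : ∀ x, g x ≤ B := le_iSup g
  rcases eq_or_ne A 0 with hA0 | hA0
  · have : ∀ x, f x = 0 := fun x => le_antisymm (hA0 ▸ hfA x) zero_le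
    simp [this, ha]
  rcases eq_or_ne B 0 with hB0 | hB0
  · have : ∀ x, g x = 0 := fun x => le_antisymm (hB0 ▸ hgB x) zero_le
    simp [this, hb]
  set C := A ^ a * B ^ b with hC
  have hC0 : C ≠ 0 := by
    simp [hC, hA0, hB0, hfb, hgb, ha.le, hb.le]
  have hCt : C ≠ ∞ := by
    refine ENNReal.mul_ne_top (ENNReal.rpow_ne_top_of_nonneg ha.le hfb) (ENNReal.rpow_ne_top_of_nonneg hb.le hgb)
  have f1 : ∀ x, f x / A ≤ 1 := fun x => ENNReal.div_le_of_le_mul (by simpa using hfA x)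
  have g1 : ∀ x, g x / B ≤ 1 := fun x => ENNReal.div_le_of_le_mul (by simpa using hgB x)
  have ft : ∀ x, f x / A ≠ ∞ := fun x => ne_top_of_le_ne_top ENNReal.one_ne_top (f1 x)
  have gt : ∀ x, g x / B ≠ ∞ := fun x => ne_top_of_le_ne_top ENNReal.one_ne_top (g1 x)
  have ht : ∀ x, min (h x / C) 1 ≠ ∞ := fun x => ne_top_of_le_ne_top ENNReal.one_ne_top (min_le_right _ _)
  have hsup : ∀ (φ : ℝ → ℝ≥0∞) (D : ℝ≥0∞), D = ⨆ x, φ x → D ≠ 0 → D ≠ ∞ → (∀ x, φ x / D ≠ ∞) →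
      ∀ t < (1:ℝ), ∃ x, t < (φ x / D).toReal := by
    intro φ D hD hD0 hDt hft t ht
    have h1 : ENNReal.ofReal t * D < D := by
      conv_rhs => rw [← one_mul D]
      exact ENNReal.mul_lt_mul_left hD0 hDt (by simpa using ht)
    obtain ⟨x, hx⟩ := lt_iSup_iff.1 (hD ▸ h1)
    rw [← hD] at hx
    refine ⟨x, ?_⟩
    rcases lt_or_ge t 0 with h0 | h0
    · exact lt_of_lt_of_le h0 ENNReal.toReal_nonneg
    rw [← ENNReal.ofReal_lt_iff_lt_toReal h0 (hft x)]
    exact (ENNReal.lt_div_iff_mul_lt (.inl hD0) (.inl hDt)).2 hx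
  have key := pl1_norm ha hb (fun x => (f x / A).toReal) (fun x => (g x / B).toReal)
    (fun x => (min (h x / C) 1).toReal) (by fun_prop) (by fun_prop) (by fun_prop)
    (fun _ => ENNReal.toReal_nonneg) (fun _ => ENNReal.toReal_nonneg) (fun _ => ENNReal.toReal_nonneg)
    (fun x => by simpa using ENNReal.toReal_mono ENNReal.one_ne_top (f1 x))
    (fun x => by simpa using ENNReal.toReal_mono ENNReal.one_ne_top (g1 x))
    (hsup f A hA hA0 hfb ft) (hsup g B hB hB0 hgb gt) (fun x y => by
      rw [← ENNReal.toReal_min (ft x) (gt y)]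
      refine ENNReal.toReal_mono (ht _) (le_min ?_ ((min_le_left _ _).trans (f1 x)))
      set m := min (f x / A) (g y / B) with hm
      have e : m = m ^ a * m ^ b := by
        rw [← ENNReal.rpow_add_of_nonneg _ _ ha.le hb.le, hab, ENNReal.rpow_one]
      rw [e]
      refine le_trans (mul_le_mul' (ENNReal.rpow_le_rpow (min_le_left _ _) ha.le)
        (ENNReal.rpow_le_rpow (min_le_right _ _) hb.le)) ?_
      rw [ENNReal.div_rpow_of_nonneg _ _ ha.le, ENNReal.div_rpow_of_nonneg _ _ hb.le,
        ENNReal.le_div_iff_mul_le (.inl hC0) (.inl hCt), hC]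
      refine le_trans (le_of_eq ?_) (H x y)
      have a1 : A ^ a ≠ 0 := by simp [hA0, ha.le, hfb]
      have a2 : A ^ a ≠ ∞ := ENNReal.rpow_ne_top_of_nonneg ha.le hfb
      have a3 : B ^ b ≠ 0 := by simp [hB0, hb.le, hgb]
      have a4 : B ^ b ≠ ∞ := ENNReal.rpow_ne_top_of_nonneg hb.le hgb
      calc f x ^ a / A ^ a * (g y ^ b / B ^ b) * (A ^ a * B ^ b)
          = (f x ^ a / A ^ a * A ^ a) * (g y ^ b / B ^ b * B ^ b) := by ring
        _ = _ := by rw [ENNReal.div_mul_cancel a1 a2, ENNReal.div_mul_cancel a3 a4])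
  simp only [ENNReal.ofReal_toReal (ft _), ENNReal.ofReal_toReal (gt _), ENNReal.ofReal_toReal (ht _)] at key
  have k2 : ∫⁻ x, min (h x / C) 1 ≤ (∫⁻ x, h x) / C := by
    rw [ENNReal.div_eq_inv_mul, ← lintegral_const_mul _ hh]
    refine lintegral_mono fun x => ?_
    rw [← ENNReal.div_eq_inv_mul]; exact min_le_left _ _
  have k3 : ∫⁻ x, f x / A = (∫⁻ x, f x) / A := by
    simp only [ENNReal.div_eq_inv_mul]; exact lintegral_const_mul _ hf
  have k4 : ∫⁻ x, g x / B = (∫⁻ x, g x) / B := by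
    simp only [ENNReal.div_eq_inv_mul]; exact lintegral_const_mul _ hg
  rw [k3, k4] at key
  have hpq : (1 / a).HolderConjugate (1 / b) := by
    rw [Real.holderConjugate_iff]
    refine ⟨?_, by simpa using hab⟩
    rw [lt_div_iff₀ ha]; linarith
  have yg := ENNReal.young_inequality (((∫⁻ x, f x) / A) ^ a) (((∫⁻ x, g x) / B) ^ b) hpq
  rw [← ENNReal.rpow_mul, ← ENNReal.rpow_mul, mul_one_div_cancel ha.ne', mul_one_div_cancel hb.ne',
    ENNReal.rpow_one, ENNReal.rpow_one] at yg
  have i1 : ∀ (X : ℝ≥0∞) (c : ℝ), 0 < c → X / ENNReal.ofReal (1 / c) = ENNReal.ofReal c * X := by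
    intro X c hc
    rw [one_div, ENNReal.ofReal_inv_of_pos hc, ENNReal.div_eq_inv_mul, inv_inv]
  rw [i1 _ _ ha, i1 _ _ hb] at yg
  have fin := (yg.trans key).trans k2
  rw [ENNReal.div_rpow_of_nonneg _ _ ha.le, ENNReal.div_rpow_of_nonneg _ _ hb.le,
    ENNReal.le_div_iff_mul_le (.inl hC0) (.inl hCt), hC] at fin
  refine le_trans (le_of_eq ?_) fin
  have a1 : A ^ a ≠ 0 := by simp [hA0, ha.le, hfb]
  have a2 : A ^ a ≠ ∞ := ENNReal.rpow_ne_top_of_nonneg ha.le hfb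
  have a3 : B ^ b ≠ 0 := by simp [hB0, hb.le, hgb]
  have a4 : B ^ b ≠ ∞ := ENNReal.rpow_ne_top_of_nonneg hb.le hgb
  symm
  generalize (∫⁻ x, f x) = X
  generalize (∫⁻ x, g x) = Y
  calc X ^ a / A ^ a * (Y ^ b / B ^ b) * (A ^ a * B ^ b)
      = (X ^ a / A ^ a * A ^ a) * (Y ^ b / B ^ b * B ^ b) := by ring
    _ = _ := by rw [ENNReal.div_mul_cancel a1 a2, ENNReal.div_mul_cancel a3 a4]

theorem trunc_tendsto (f : ℝ → ℝ≥0∞) (hf : Measurable f) :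
    Filter.Tendsto (fun n : ℕ => ∫⁻ x, min (f x) n) Filter.atTop (nhds (∫⁻ x, f x)) := by
  refine lintegral_tendsto_of_tendsto_of_monotone (fun n => by fun_prop) ?_ ?_
  · refine .of_forall fun x => fun m n hmn => min_le_min le_rfl (by exact_mod_cast hmn)
  · refine .of_forall fun x => ?_
    have := (tendsto_const_nhds (x := f x)).min ENNReal.tendsto_nat_nhds_top
    simpa using this

theorem pl_real : PL ℝ := by
  intro a b ha hb hab f g h hf hg hh H
  rcases eq_or_ne (∫⁻ x, f x) 0 with h0 | h0
  · simp [h0, ha]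
  rcases eq_or_ne (∫⁻ x, g x) 0 with h1 | h1
  · simp [h1, hb]
  have T := ENNReal.Tendsto.mul
    ((ENNReal.continuous_rpow_const (y := a)).tendsto _ |>.comp (trunc_tendsto f hf)) 
    (.inl (by simp [h0, ha.le, ha, ha.not_gt]))
    ((ENNReal.continuous_rpow_const (y := b)).tendsto _ |>.comp (trunc_tendsto g hg)) 
    (.inl (by simp [h1, hb.le, hb, hb.not_gt]))
  refine le_of_tendsto' T fun n => ?_
  refine pl_bdd ha hb hab _ _ _ (by fun_prop) (by fun_prop) hh (fun x y => ?_) ?_ ?_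
  · refine le_trans (mul_le_mul' (ENNReal.rpow_le_rpow (min_le_left _ _) ha.le)
        (ENNReal.rpow_le_rpow (min_le_left _ _) hb.le)) (H x y)
  · exact ne_top_of_le_ne_top (ENNReal.natCast_ne_top n) (iSup_le fun x => min_le_right _ _)
  · exact ne_top_of_le_ne_top (ENNReal.natCast_ne_top n) (iSup_le fun x => min_le_right _ _)

theorem pl_pi (n : ℕ) : PL (Fin n → ℝ) := by
  induction n with
  | zero =>
    intro a b ha hb hab f g h hf hg hh H
    simp only [Measure.volume_pi_eq_dirac (0 : Fin 0 → ℝ), lintegral_dirac]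
    simpa using H 0 0
  | succ n ih =>
    refine pl_transfer (MeasurableEquiv.piFinSuccAbove (fun _ => ℝ) 0).symm
      (volume_preserving_piFinSuccAbove (fun _ => ℝ) 0).symm ?_ (pl_prod pl_real ih)
    intro a b x y
    rfl

theorem pl_euclid (n : ℕ) : PL (EuclideanSpace ℝ (Fin n)) := by
  refine pl_transfer (MeasurableEquiv.toLp 2 (Fin n → ℝ)) (PiLp.volume_preserving_toLp (Fin n)) ?_ (pl_pi n)
  intro a b x y
  rfl

noncomputable def tors (N : ℕ) (ρ : ℝ) (y : EuclideanSpace ℝ (Fin N)) : ℝ :=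
  max ((ρ ^ 2 - ‖y‖ ^ 2) / (2 * N)) 0

theorem hcs_sq {E : Type*} [TopologicalSpace E] [R1Space E] {u : E → ℝ} (hc : HasCompactSupport u) :
    HasCompactSupport (fun x => u x ^ 2) :=
  HasCompactSupport.intro hc.isCompact fun x hx => by rw [image_eq_zero_of_notMem_tsupport hx]; norm_num

theorem le_of_small {X Y C ε₀ : ℝ} (h0 : 0 < ε₀) (h : ∀ ε, 0 < ε → ε < ε₀ → X ≤ Y + ε * C) : X ≤ Y := by
  have T : Filter.Tendsto (fun ε : ℝ => Y + ε * C) (nhdsWithin 0 (Set.Ioi 0)) (nhds Y) := by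
    have : Continuous fun ε : ℝ => Y + ε * C := by fun_prop
    simpa using (this.tendsto 0).mono_left nhdsWithin_le_nhds
  refine ge_of_tendsto T ?_
  filter_upwards [Ioo_mem_nhdsGT h0] with ε hε using h ε hε.1 hε.2

theorem gn_ptwise {N : ℕ} (hN : 1 ≤ N) {u : EuclideanSpace ℝ (Fin N) → ℝ} (hu : ContDiff ℝ 1 u)
    {ρ η ε δ : ℝ} (hρ : 0 < ρ) (hη : 0 < η) (hε : 0 < ε) (hεδ : ε * ρ < δ)
    (hδ : ∀ x y, dist x y < δ → dist (fderiv ℝ u x) (fderiv ℝ u y) < η / ρ)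
    (x y : EuclideanSpace ℝ (Fin N)) (hy : 0 < tors N ρ y) :
    u x + ε * tors N ρ y ≤ u (x + ε • y) + ε * (ρ ^ 2 / (2 * N) + N * ‖fderiv ℝ u (x + ε • y)‖ ^ 2 / 2 + η) := by
  have hN' : (0:ℝ) < N := by exact_mod_cast hN
  have hy1 : tors N ρ y = (ρ ^ 2 - ‖y‖ ^ 2) / (2 * N) := by
    unfold tors at hy ⊢
    rcases max_cases ((ρ ^ 2 - ‖y‖ ^ 2) / (2 * N)) 0 with h | h
    · exact h.1
    · rw [h.1] at hy; exact absurd hy (lt_irrefl _)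
  have hyρ : ‖y‖ < ρ := by
    rw [hy1] at hy
    have := (div_pos_iff_of_pos_right (by positivity)).1 hy
    nlinarith [norm_nonneg y]
  set w := x + ε • y with hw
  have hb : ∀ z ∈ Metric.ball w δ, ‖fderiv ℝ u z - fderiv ℝ u w‖ ≤ η / ρ := by
    intro z hz
    rw [← dist_eq_norm]; exact (hδ z w hz).le
  have hxw : x - w = -(ε • y) := by rw [hw]; abel
  have hnx : ‖x - w‖ ≤ ε * ρ := by
    rw [hxw, norm_neg, norm_smul, Real.norm_of_nonneg hε.le]; gcongr
  have hxb : x ∈ Metric.ball w δ := by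
    rw [Metric.mem_ball, dist_eq_norm]; linarith
  have mv := (convex_ball w δ).norm_image_sub_le_of_norm_fderiv_le'
    (fun z _ => (hu.differentiable one_ne_zero) z) hb
    (Metric.mem_ball_self (lt_of_le_of_lt (by positivity) hεδ)) hxb
  have m2 : η / ρ * ‖x - w‖ ≤ ε * η := by
    calc η / ρ * ‖x - w‖ ≤ η / ρ * (ε * ρ) := by gcongr
      _ = ε * η := by field_simp
  have m3 := (le_abs_self _).trans (mv.trans m2)
  rw [hxw, map_neg, map_smul, smul_eq_mul] at m3
  have m4 : -(fderiv ℝ u w y) ≤ ‖fderiv ℝ u w‖ * ‖y‖ :=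
    (neg_le_abs _).trans ((fderiv ℝ u w).le_opNorm y)
  have m5 : ‖fderiv ℝ u w‖ * ‖y‖ ≤ N * ‖fderiv ℝ u w‖ ^ 2 / 2 + ‖y‖ ^ 2 / (2 * N) := by
    have : N * ‖fderiv ℝ u w‖ ^ 2 / 2 + ‖y‖ ^ 2 / (2 * N) - ‖fderiv ℝ u w‖ * ‖y‖
      = (N * ‖fderiv ℝ u w‖ - ‖y‖) ^ 2 / (2 * N) := by field_simp; ring
    have h2 : 0 ≤ (N * ‖fderiv ℝ u w‖ - ‖y‖) ^ 2 / (2 * N) := by positivity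
    linarith
  rw [hy1, sub_div]
  nlinarith

theorem sq_rpow_aux {s t : ℝ} (hs : 0 ≤ s) (ht : 0 ≤ t) (a b : ℝ) :
    (s ^ 2) ^ a * (t ^ 2) ^ b = (s ^ a * t ^ b) ^ 2 := by
  rw [mul_pow, ← Real.rpow_natCast, ← Real.rpow_natCast, ← Real.rpow_natCast, ← Real.rpow_natCast,
    ← Real.rpow_mul hs, ← Real.rpow_mul hs, ← Real.rpow_mul ht, ← Real.rpow_mul ht,
    mul_comm a, mul_comm b]

theorem gn_eps {N : ℕ} (hN : 1 ≤ N) {u : EuclideanSpace ℝ (Fin N) → ℝ} (hu : ContDiff ℝ 1 u)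
    (hc : HasCompactSupport u) (h0 : ∀ x, 0 ≤ u x)
    {ρ η ε δ : ℝ} (hρ : 0 < ρ) (hη : 0 < η) (hε : 0 < ε) (hε1 : ε < 1) (hεδ : ε * ρ < δ)
    (hδ : ∀ x y, dist x y < δ → dist (fderiv ℝ u x) (fderiv ℝ u y) < η / ρ)
    (hb : ∫ y, tors N ρ y ^ 2 = ∫ x, u x ^ 2) :
    (1 + ε) ^ (N + 2) * ∫ x, u x ^ 2 ≤ ∫ w in Metric.cthickening ρ (tsupport u),
      (u w + ε * (ρ ^ 2 / (2 * N) + N * ‖fderiv ℝ u w‖ ^ 2 / 2 + η)) ^ 2 := by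
  have hN' : (0:ℝ) < N := by exact_mod_cast hN
  have hcu := hu.continuous
  have hcd := hu.continuous_fderiv one_ne_zero
  set K := Metric.cthickening ρ (tsupport u) with hK
  have hKc : IsCompact K := hc.isCompact.cthickening
  set G : EuclideanSpace ℝ (Fin N) → ℝ := fun w =>
    (u w + ε * (ρ ^ 2 / (2 * N) + N * ‖fderiv ℝ u w‖ ^ 2 / 2 + η)) ^ 2 with hG
  have hGc : Continuous G := by fun_prop
  have hG0 : ∀ w, 0 ≤ G w := fun w => sq_nonneg _
  set H : EuclideanSpace ℝ (Fin N) → ℝ := K.indicator G with hH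
  have hHm : Measurable H := hGc.measurable.indicator hKc.measurableSet
  have hH0 : ∀ w, 0 ≤ H w := fun w => Set.indicator_nonneg (fun w _ => hG0 w) w
  have hHi : Integrable H := (hGc.continuousOn.integrableOn_compact hKc).integrable_indicator hKc.measurableSet
  have ht : Continuous (tors N ρ) := by unfold tors; fun_prop
  have ht0 : ∀ y, 0 ≤ tors N ρ y := fun y => le_max_right _ _
  have htc : HasCompactSupport (tors N ρ) := by
    refine HasCompactSupport.intro (isCompact_closedBall 0 ρ) fun y hy => ?_
    unfold tors
    refine max_eq_right (div_nonpos_of_nonpos_of_nonneg ?_ (by positivity))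
    simp only [Metric.mem_closedBall, dist_zero_right, not_le] at hy
    nlinarith
  set a := 1 / (1 + ε) with ha
  have ha0 : 0 < a := by positivity
  have hae : a * (1 + ε) = 1 := by rw [ha]; field_simp
  have hPL : ∀ x y, ENNReal.ofReal (u x ^ 2) ^ a * ENNReal.ofReal (tors N ρ y ^ 2) ^ (a * ε) ≤
      ENNReal.ofReal (a ^ 2 * H ((1 + ε) • (a • x + (a * ε) • y))) := by
    intro x y
    have hb0 : 0 < a * ε := by positivity
    rw [ENNReal.ofReal_rpow_of_nonneg (by positivity) ha0.le,
      ENNReal.ofReal_rpow_of_nonneg (by positivity) hb0.le,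
      ← ENNReal.ofReal_mul (by positivity)]
    refine ENNReal.ofReal_le_ofReal ?_
    rcases eq_or_lt_of_le (h0 x) with hx | hx
    · rw [← hx]
      rw [zero_pow two_ne_zero, Real.zero_rpow ha0.ne', zero_mul]
      exact mul_nonneg (by positivity) (hH0 _)
    rcases eq_or_lt_of_le (ht0 y) with hy | hy
    · rw [← hy]
      rw [zero_pow two_ne_zero, Real.zero_rpow hb0.ne', mul_zero]
      exact mul_nonneg (by positivity) (hH0 _)
    have e1 : (1 + ε) • (a • x + (a * ε) • y) = x + ε • y := by
      rw [smul_add, smul_smul, smul_smul, mul_comm (1 + ε), hae, one_smul]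
      congr 2
      calc (1 + ε) * (a * ε) = (a * (1 + ε)) * ε := by ring
        _ = ε := by rw [hae, one_mul]
    rw [e1]
    have hmem : x + ε • y ∈ K := by
      refine Metric.mem_cthickening_of_dist_le _ x _ _ (subset_tsupport _ hx.ne') ?_
      rw [dist_eq_norm, add_sub_cancel_left, norm_smul, Real.norm_of_nonneg hε.le]
      have : ‖y‖ ≤ ρ := by
        by_contra hcon
        have : tors N ρ y = 0 := by
          unfold tors
          refine max_eq_right (div_nonpos_of_nonpos_of_nonneg ?_ (by positivity))
          nlinarith
        exact hy.ne' this
      nlinarith [norm_nonneg y]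
    rw [hH, Set.indicator_of_mem hmem, hG]
    have pt := gn_ptwise hN hu hρ hη hε hεδ hδ x y hy
    have am := Real.geom_mean_le_arith_mean2_weighted ha0.le hb0.le (h0 x) (ht0 y) (by linarith)
    have e2 := sq_rpow_aux (h0 x) (ht0 y) a (a * ε)
    rw [e2, ← mul_pow]
    refine pow_le_pow_left₀ (by positivity) (am.trans ?_) 2
    calc a * u x + a * ε * tors N ρ y = a * (u x + ε * tors N ρ y) := by ring
      _ ≤ _ := by gcongr
  have m1 : Measurable (fun x => ENNReal.ofReal (u x ^ 2)) := (hcu.pow 2).measurable.ennreal_ofReal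
  have m2 : Measurable (fun x => ENNReal.ofReal (tors N ρ x ^ 2)) := (ht.pow 2).measurable.ennreal_ofReal
  have m3 : Measurable (fun z => ENNReal.ofReal (a ^ 2 * H ((1 + ε) • z))) :=
    ((hHm.comp (measurable_const_smul (1 + ε))).const_mul _).ennreal_ofReal
  have hab : a + a * ε = 1 := by linarith
  have haε : 0 < a * ε := by positivity
  have key := pl_euclid N a (a * ε) ha0 haε hab _ _ _ m1 m2 m3 hPL
  have hui : Integrable (fun x => u x ^ 2) :=
    (hcu.pow 2).integrable_of_hasCompactSupport (hcs_sq hc)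
  have hti : Integrable (fun x => tors N ρ x ^ 2) :=
    (ht.pow 2).integrable_of_hasCompactSupport (hcs_sq htc)
  rw [← ofReal_integral_eq_lintegral_ofReal hui (.of_forall fun x => sq_nonneg _),
    ← ofReal_integral_eq_lintegral_ofReal hti (.of_forall fun x => sq_nonneg _), hb,
    ← ENNReal.rpow_add_of_nonneg _ _ ha0.le (by positivity),
    show a + a * ε = 1 by linarith, ENNReal.rpow_one,
    ← ofReal_integral_eq_lintegral_ofReal ((hHi.comp_smul (by positivity)).const_mul _)
      (.of_forall fun x => mul_nonneg (by positivity) (hH0 _)),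
    ENNReal.ofReal_le_ofReal_iff (integral_nonneg fun x => mul_nonneg (by positivity) (hH0 _)),
    integral_const_mul, Measure.integral_comp_smul, finrank_euclideanSpace_fin,
    hH, integral_indicator hKc.measurableSet, abs_of_nonneg (by positivity), smul_eq_mul] at key
  refine (mul_le_mul_of_nonneg_left key (by positivity)).trans (le_of_eq ?_)
  rw [ha, pow_add]
  field_simp

theorem gn {N : ℕ} (hN : 1 ≤ N) {u : EuclideanSpace ℝ (Fin N) → ℝ} (hu : ContDiff ℝ 1 u)
    (hc : HasCompactSupport u) (h0 : ∀ x, 0 ≤ u x)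
    {ρ : ℝ} (hρ : 0 < ρ) (hb : ∫ y, tors N ρ y ^ 2 = ∫ x, u x ^ 2) :
    (N + 2) * ∫ x, u x ^ 2 ≤ ρ ^ 2 / N * (∫ x, u x) + N * ∫ x, u x * ‖fderiv ℝ u x‖ ^ 2 := by
  have hN' : (0:ℝ) < N := by exact_mod_cast hN
  have hcu := hu.continuous
  have hcd := hu.continuous_fderiv one_ne_zero
  set K := Metric.cthickening ρ (tsupport u) with hK
  have hKc : IsCompact K := hc.isCompact.cthickening
  have hz : ∀ x, x ∉ K → u x = 0 := fun x hx => by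
    by_contra h
    exact hx (Metric.self_subset_cthickening _ (subset_tsupport _ h))
  have hui : Integrable u := hcu.integrable_of_hasCompactSupport hc
  have hugi : Integrable fun x => u x * ‖fderiv ℝ u x‖ ^ 2 :=
    (by fun_prop : Continuous fun x => u x * ‖fderiv ℝ u x‖ ^ 2).integrable_of_hasCompactSupport
      hc.mul_right
  have hucd : UniformContinuous (fderiv ℝ u) :=
    HasCompactSupport.uniformContinuous_of_continuous (hc.fderiv ℝ) hcd
  refine le_of_small (C := 2 * ∫ x, u x) one_pos fun η hη _ => ?_
  obtain ⟨δ, hδ0, hδ⟩ := Metric.uniformContinuous_iff.1 hucd (η / ρ) (by positivity)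
  set S : EuclideanSpace ℝ (Fin N) → ℝ := fun w =>
    ρ ^ 2 / (2 * N) + N * ‖fderiv ℝ u w‖ ^ 2 / 2 + η with hS
  have hSc : Continuous S := by fun_prop
  refine le_of_small (C := ∫ w in K, S w ^ 2) (ε₀ := min 1 (δ / ρ)) (by positivity) fun ε hε hε1 => ?_
  have hεδ : ε * ρ < δ := by
    rw [← lt_div_iff₀ hρ]; exact hε1.trans_le (min_le_right _ _)
  have key := gn_eps hN hu hc h0 hρ hη hε (hε1.trans_le (min_le_left _ _)) hεδ (fun x y => @hδ x y) hb
  have i1 : IntegrableOn (fun w => u w ^ 2) K := (hcu.pow 2).continuousOn.integrableOn_compact hKc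
  have i2 : IntegrableOn (fun w => (2 * ε) * (u w * S w)) K := 
    (by fun_prop : Continuous fun w => (2 * ε) * (u w * S w)).continuousOn.integrableOn_compact hKc
  have i3 : IntegrableOn (fun w => ε ^ 2 * S w ^ 2) K := 
    (by fun_prop : Continuous fun w => ε ^ 2 * S w ^ 2).continuousOn.integrableOn_compact hKc
  have i12 : IntegrableOn (fun w => u w ^ 2 + (2 * ε) * (u w * S w)) K := i1.add i2
  have e1 : ∫ w in K, (u w + ε * S w) ^ 2 = (∫ x, u x ^ 2) + (2 * ε) * (∫ w, u w * S w)
      + ε ^ 2 * ∫ w in K, S w ^ 2 := by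
    have : ∀ w, (u w + ε * S w) ^ 2 = u w ^ 2 + (2 * ε) * (u w * S w) + ε ^ 2 * S w ^ 2 := by
      intro w; ring
    simp only [this]
    rw [integral_add i12 i3, integral_add i1 i2, integral_const_mul, integral_const_mul,
      setIntegral_eq_integral_of_forall_compl_eq_zero (fun x hx => by simp [hz x hx]),
      setIntegral_eq_integral_of_forall_compl_eq_zero (fun x hx => by simp [hz x hx])]
  change _ ≤ ∫ w in K, (u w + ε * S w) ^ 2 at key
  rw [e1] at key
  have e2 : 2 * ∫ w, u w * S w = ρ ^ 2 / N * (∫ x, u x) + N * (∫ x, u x * ‖fderiv ℝ u x‖ ^ 2)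
      + η * (2 * ∫ x, u x) := by
    have : ∀ w, u w * S w = (ρ ^ 2 / (2 * N) + η) * u w + (N / 2) * (u w * ‖fderiv ℝ u w‖ ^ 2) := by
      intro w; rw [hS]; ring
    simp only [this]
    rw [integral_add (hui.const_mul _) (hugi.const_mul _), integral_const_mul, integral_const_mul]
    field_simp
    ring
  have ber := one_add_mul_le_pow (a := ε) (by linarith) (N + 2)
  push_cast at ber
  have hbn : 0 ≤ ∫ x, u x ^ 2 := integral_nonneg fun x => sq_nonneg _
  have k2 := (mul_le_mul_of_nonneg_right ber hbn).trans key
  rw [← e2]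
  have k3 : ε * ((N + 2) * ∫ x, u x ^ 2) ≤ ε * (2 * (∫ w, u w * S w) + ε * ∫ w in K, S w ^ 2) := by
    nlinarith
  exact le_of_mul_le_mul_left k3 hε

theorem tors_sq_integral {N : ℕ} (hN : 1 ≤ N) {ρ : ℝ} (hρ : 0 < ρ) :
    ∫ y, tors N ρ y ^ 2 = 2 * (volume (Metric.ball (0 : EuclideanSpace ℝ (Fin N)) 1)).toReal * ρ ^ (N + 4)
      / ((N:ℝ) ^ 2 * (N + 2) * (N + 4)) := by
  have hN' : (0:ℝ) < N := by exact_mod_cast hN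
  haveI : Nonempty (Fin N) := ⟨⟨0, hN⟩⟩
  have h1 := integral_fun_norm_addHaar (volume : Measure (EuclideanSpace ℝ (Fin N)))
    (fun r => max ((ρ ^ 2 - r ^ 2) / (2 * N)) 0 ^ 2)
  unfold tors
  rw [h1, finrank_euclideanSpace_fin]
  have h2 : ∫ y in Set.Ioi (0:ℝ), y ^ (N - 1) • max ((ρ ^ 2 - y ^ 2) / (2 * N)) 0 ^ 2
      = ∫ y in (0:ℝ)..ρ, (1 / (4 * (N:ℝ) ^ 2)) * (ρ ^ 4 * y ^ (N - 1) - 2 * ρ ^ 2 * y ^ (N + 1) + y ^ (N + 3)) := by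
    rw [intervalIntegral.integral_of_le hρ.le]
    rw [setIntegral_eq_of_subset_of_forall_diff_eq_zero (s := Set.Ioc 0 ρ) (t := Set.Ioi 0) measurableSet_Ioi
      Set.Ioc_subset_Ioi_self ?_]
    · refine setIntegral_congr_fun measurableSet_Ioc fun y hy => ?_
      have : 0 ≤ (ρ ^ 2 - y ^ 2) / (2 * N) := by
        refine div_nonneg ?_ (by positivity)
        have := hy.1; have := hy.2; nlinarith
      simp only [smul_eq_mul]
      rw [max_eq_left this]
      obtain ⟨k, rfl⟩ : ∃ k, N = k + 1 := ⟨N - 1, by omega⟩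
      simp only [Nat.add_sub_cancel]
      field_simp
      ring
    · intro y hy
      have hy' : ρ < y := by
        by_contra h
        exact hy.2 ⟨hy.1, not_lt.1 h⟩
      have : max ((ρ ^ 2 - y ^ 2) / (2 * (N:ℝ))) 0 = 0 := by
        refine max_eq_right (div_nonpos_of_nonpos_of_nonneg ?_ (by positivity))
        nlinarith
      rw [this]; simp
  rw [h2, intervalIntegral.integral_const_mul, intervalIntegral.integral_add, intervalIntegral.integral_sub,
    intervalIntegral.integral_const_mul, intervalIntegral.integral_const_mul, integral_pow, integral_pow, integral_pow]
  · obtain ⟨k, rfl⟩ : ∃ k, N = k + 1 := ⟨N - 1, by omega⟩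
    simp only [Nat.add_sub_cancel, Measure.real, nsmul_eq_mul, smul_eq_mul]
    push_cast
    field_simp
    ring
  all_goals apply Continuous.intervalIntegrable; fun_prop

set_option maxHeartbeats 1000000 in
theorem var_bound {N : ℕ} (hN : 1 ≤ N) {z : EuclideanSpace ℝ (Fin N) → ℝ} (hz : ContDiff ℝ 1 z)
    (hc : HasCompactSupport z) (h0 : ∀ x, 0 ≤ z x) {e R κ : ℝ} (he : 0 ≤ e) (hR : 0 < R)
    (hκ : κ = (volume (Metric.ball (0 : EuclideanSpace ℝ (Fin N)) 1)).toReal)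
    (h : 2 * ∫ x, z x * ‖fderiv ℝ z x‖ ^ 2 ≤ (∫ x, z x ^ 2) + e) :
    (∫ x, z x ^ 2) - (∫ x, z x) ^ 2 / (κ * R ^ N) ≤
      κ * R ^ (N + 4) / (N * (N + 2) ^ 2 * (N + 4)) + 2 * e := by
  have hN' : (0:ℝ) < N := by exact_mod_cast hN
  have hκ0 : 0 < κ := by
    rw [hκ]
    exact ENNReal.toReal_pos (Metric.measure_ball_pos _ _ one_pos).ne' measure_ball_lt_top.ne
  set b := ∫ x, z x ^ 2 with hb
  set a := ∫ x, z x with ha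
  have ha0 : 0 ≤ a := integral_nonneg h0
  have hb0 : 0 ≤ b := integral_nonneg fun x => sq_nonneg _
  have hV : 0 < κ * R ^ N := by positivity
  rcases eq_or_lt_of_le hb0 with hb1 | hb1
  · rw [← hb1]
    have : 0 ≤ a ^ 2 / (κ * R ^ N) := by positivity
    have : 0 ≤ κ * R ^ (N + 4) / (N * (N + 2) ^ 2 * (N + 4)) := by positivity
    linarith
  set β := 2 * κ / ((N:ℝ) ^ 2 * (N + 2) * (N + 4)) with hβ
  have hβ0 : 0 < β := by positivity
  set ρ := (b / β) ^ (1 / ((N + 4 : ℕ) : ℝ)) with hρ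
  have hρ0 : 0 < ρ := by positivity
  have hρb : β * ρ ^ (N + 4) = b := by
    rw [hρ, ← Real.rpow_natCast, ← Real.rpow_mul (by positivity), one_div,
      inv_mul_cancel₀ (by positivity), Real.rpow_one]
    field_simp
  have g := gn hN hz hc h0 hρ0 (by
    rw [tors_sq_integral hN hρ0, ← hκ, ← hb, ← hρb, hβ]; ring)
  rw [← hb, ← ha] at g
  set T := κ * ρ ^ (N + 2) / (N * (N + 2)) with hT
  have hT0 : 0 < T := by positivity
  have hTb : T * ρ ^ 2 = N * (N + 4) * b / 2 := by
    rw [hT, ← hρb, hβ]; field_simp; ring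
  set θ := N * e / ((N + 4) * b) with hθ
  have hθ0 : 0 ≤ θ := by positivity
  have hθb : θ * b = N * e / (N + 4) := by rw [hθ]; field_simp
  have hθe : θ * b ≤ e := by
    rw [hθb, div_le_iff₀ (by positivity)]; nlinarith
  have haT : T * (1 - θ) ≤ a := by
    have : ρ ^ 2 * (T * (1 - θ)) ≤ ρ ^ 2 * a := by
      have e1 : ρ ^ 2 * (T * (1 - θ)) = N * (N + 4) / 2 * (b - θ * b) := by
        calc ρ ^ 2 * (T * (1 - θ)) = (T * ρ ^ 2) * (1 - θ) := by ring
          _ = _ := by rw [hTb]; ring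
      rw [e1, hθb]
      have e2 : ρ ^ 2 / N * a = ρ ^ 2 * a / N := by ring
      rw [e2] at g
      have e3 : ρ ^ 2 * a = N * (ρ ^ 2 * a / N) := by field_simp
      rw [e3]
      have e4 : (N:ℝ) * (N + 4) / 2 * (b - N * e / (N + 4)) = N * ((N + 4) / 2 * b - N * e / 2) := by
        field_simp
      rw [e4]
      have : (N:ℝ) * (2 * ∫ x, z x * ‖fderiv ℝ z x‖ ^ 2) ≤ N * (b + e) := by gcongr
      gcongr
      nlinarith
    exact le_of_mul_le_mul_left this (by positivity)
  have haT2 : T ^ 2 * (1 - 2 * θ) ≤ a ^ 2 := by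
    rcases le_or_gt θ 1 with h1 | h1
    · have : (T * (1 - θ)) ^ 2 ≤ a ^ 2 := pow_le_pow_left₀ (mul_nonneg hT0.le (by linarith)) haT 2
      nlinarith [mul_nonneg (sq_nonneg T) (sq_nonneg θ)]
    · nlinarith [sq_nonneg a, sq_pos_of_pos hT0]
  have hX0 : 0 < κ * R ^ (N + 4) / (N * (N + 2) ^ 2 * (N + 4)) := by positivity
  have hbT : b - T ^ 2 / (κ * R ^ N) ≤ κ * R ^ (N + 4) / (N * (N + 2) ^ 2 * (N + 4)) := by
    have y := Real.geom_mean_le_arith_mean2_weighted (w₁ := N / (2 * N + 4)) (w₂ := (N + 4) / (2 * N + 4))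
      (p₁ := R ^ (2 * N + 4)) (p₂ := ρ ^ (2 * N + 4)) (by positivity) (by positivity) (by positivity)
      (by positivity) (by field_simp; ring)
    have y1 : (R ^ (2 * N + 4)) ^ ((N:ℝ) / (2 * N + 4)) = R ^ N := by
      rw [← Real.rpow_natCast, ← Real.rpow_mul hR.le, ← Real.rpow_natCast]
      congr 1
      push_cast; field_simp
    have y2 : (ρ ^ (2 * N + 4)) ^ (((N:ℝ) + 4) / (2 * N + 4)) = ρ ^ (N + 4) := by
      rw [← Real.rpow_natCast, ← Real.rpow_mul hρ0.le, ← Real.rpow_natCast]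
      congr 1
      push_cast; field_simp
    rw [y1, y2] at y
    rw [← hρb, hβ, hT, sub_le_iff_le_add]
    have e1 : κ * R ^ (N + 4) / (N * (N + 2) ^ 2 * (N + 4)) + (κ * ρ ^ (N + 2) / (N * (N + 2))) ^ 2 / (κ * R ^ N)
      = (κ / R ^ N) * (2 / (N ^ 2 * (N + 2) * (N + 4))) * (N / (2 * N + 4) * R ^ (2 * N + 4) + (N + 4) / (2 * N + 4) * ρ ^ (2 * N + 4)) := by
      field_simp
      ring
    have e2 : 2 * κ / ((N:ℝ) ^ 2 * (N + 2) * (N + 4)) * ρ ^ (N + 4) = (κ / R ^ N) * (2 / (N ^ 2 * (N + 2) * (N + 4))) * (R ^ N * ρ ^ (N + 4)) := by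
      field_simp
    rw [e1, e2]
    gcongr
  have hfin : b - a ^ 2 / (κ * R ^ N) ≤ b - T ^ 2 / (κ * R ^ N) * (1 - 2 * θ) := by
    have : T ^ 2 / (κ * R ^ N) * (1 - 2 * θ) ≤ a ^ 2 / (κ * R ^ N) := by
      rw [div_mul_eq_mul_div]; gcongr
    linarith
  rcases le_or_gt (2 * θ) 1 with h1 | h1
  · nlinarith
  · have : 0 ≤ a ^ 2 / (κ * R ^ N) := by positivity
    nlinarith

abbrev Eu (N : ℕ) := EuclideanSpace ℝ (Fin N)

/-- partial derivative -/
noncomputable def pd {N : ℕ} (i : Fin N) (u : Eu N → ℝ) (x : Eu N) : ℝ :=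
  fderiv ℝ u x (EuclideanSpace.single i 1)

noncomputable def ip {N : ℕ} (u q : Eu N → ℝ) (x : Eu N) : ℝ := ∑ i, pd i u x * pd i q x

structure Adm {N : ℕ} (W : Set (Eu N)) (u : Eu N → ℝ) : Prop where
  smooth : ContDiff ℝ 1 u
  cpt : HasCompactSupport u
  sub : tsupport u ⊆ W

noncomputable def Dir {N : ℕ} (u : Eu N → ℝ) : ℝ := ∫ x, ‖fderiv ℝ u x‖ ^ 2

noncomputable def JJ {N : ℕ} (u : Eu N → ℝ) : ℝ := 1 / 2 * Dir u - ∫ x, u x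

theorem norm_fderiv_sq {N : ℕ} (u : Eu N → ℝ) (x : Eu N) : ‖fderiv ℝ u x‖ ^ 2 = ∑ i, pd i u x ^ 2 := by
  have h1 : ‖fderiv ℝ u x‖ = ‖(InnerProductSpace.toDual ℝ (Eu N)).symm (fderiv ℝ u x)‖ := by simp
  rw [h1, EuclideanSpace.norm_sq_eq]
  refine Finset.sum_congr rfl fun i _ => ?_
  have h2 : ((InnerProductSpace.toDual ℝ (Eu N)).symm (fderiv ℝ u x)) i = pd i u x := by
    rw [pd, ← InnerProductSpace.toDual_symm_apply, EuclideanSpace.inner_single_right]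
    simp
  rw [h2, Real.norm_eq_abs, sq_abs]

namespace Adm
variable {N : ℕ} {W : Set (Eu N)} {u q : Eu N → ℝ}

theorem cont (h : Adm W u) : Continuous u := h.smooth.continuous
theorem diff (h : Adm W u) : Differentiable ℝ u := h.smooth.differentiable one_ne_zero
theorem cfd (h : Adm W u) : Continuous (fderiv ℝ u) := h.smooth.continuous_fderiv one_ne_zero
theorem cpd (h : Adm W u) (i : Fin N) : Continuous (pd i u) := by
  have := h.cfd
  unfold pd; fun_prop

theorem zero (h : Adm W u) {x : Eu N} (hx : x ∉ W) : u x = 0 :=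
  image_eq_zero_of_notMem_tsupport fun h' => hx (h.sub h')

theorem fzero (h : Adm W u) {x : Eu N} (hx : x ∉ W) : fderiv ℝ u x = 0 :=
  image_eq_zero_of_notMem_tsupport fun h' => hx (h.sub (tsupport_fderiv_subset ℝ h'))

/-- any continuous function vanishing wherever `u` is locally zero is integrable -/
theorem integ (h : Adm W u) {f : Eu N → ℝ} (hf : Continuous f) (h0 : ∀ x, x ∉ tsupport u → f x = 0) :
    Integrable f :=
  hf.integrable_of_hasCompactSupport (HasCompactSupport.intro h.cpt.isCompact h0)

theorem u0 (x : Eu N) (hx : x ∉ tsupport u) : u x = 0 := image_eq_zero_of_notMem_tsupport hx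
theorem f0 (x : Eu N) (hx : x ∉ tsupport u) : fderiv ℝ u x = 0 :=
  image_eq_zero_of_notMem_tsupport fun h' => hx (tsupport_fderiv_subset ℝ h')
theorem p0 (i : Fin N) (x : Eu N) (hx : x ∉ tsupport u) : pd i u x = 0 := by
  rw [pd, f0 x hx]; simp

theorem iu (h : Adm W u) : Integrable u := h.integ h.cont u0
theorem iu2 (h : Adm W u) : Integrable fun x => u x ^ 2 :=
  h.integ (h.cont.pow 2) fun x hx => by rw [u0 x hx]; norm_num
theorem iD (h : Adm W u) : Integrable fun x => ‖fderiv ℝ u x‖ ^ 2 :=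
  h.integ (h.cfd.norm.pow 2) fun x hx => by rw [f0 x hx]; norm_num
theorem iip (h : Adm W u) (hq : Adm W q) : Integrable (ip u q) :=
  h.integ (by unfold ip; exact continuous_finsetSum _ fun i _ => (h.cpd i).mul (hq.cpd i))
    fun x hx => by simp [ip, p0 _ x hx]

/-- Poincare inequality -/
theorem poincare (h : Adm W u) (hN : 1 ≤ N) {L : ℝ} (hW : W ⊆ Metric.ball 0 L) :
    ∫ x, u x ^ 2 ≤ 4 * L ^ 2 * Dir u := by
  set i : Fin N := ⟨0, hN⟩
  have hd2 : ∀ x, HasFDerivAt (fun x => u x ^ 2) ((2 * u x) • fderiv ℝ u x) x := fun x => by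
    have := (h.diff x).hasFDerivAt.pow 2
    simpa using this
  have hp : ∀ x : Eu N, HasFDerivAt (fun x : Eu N => x i) (EuclideanSpace.proj i : Eu N →L[ℝ] ℝ) x :=
    fun x => (EuclideanSpace.proj i : Eu N →L[ℝ] ℝ).hasFDerivAt
  have c1 : Continuous fun x : Eu N => x i := (EuclideanSpace.proj i : Eu N →L[ℝ] ℝ).continuous
  have hcu := h.cont
  have hcp := h.cpd i
  have e1 : ∀ x, fderiv ℝ (fun x : Eu N => x i) x (EuclideanSpace.single i 1) = 1 := fun x => by
    rw [(hp x).fderiv]; simp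
  have e2 : ∀ x, fderiv ℝ (fun x => u x ^ 2) x (EuclideanSpace.single i 1) = 2 * u x * pd i u x := fun x => by
    rw [(hd2 x).fderiv]; simp [pd]
  have ibp := integral_mul_fderiv_eq_neg_fderiv_mul_of_integrable (μ := (volume : Measure (Eu N)))
    (f := fun x : Eu N => x i) (g := fun x => u x ^ 2) (v := EuclideanSpace.single i 1)
    (by simp only [e1, one_mul]; exact h.iu2)
    (by
      simp only [e2]
      exact h.integ (by fun_prop) fun x hx => by rw [u0 x hx]; ring)
    (h.integ (by fun_prop) fun x hx => by rw [u0 x hx]; ring)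
    (fun x _ => (hp x).differentiableAt) (fun x _ => (hd2 x).differentiableAt)
  simp only [e1, e2, one_mul] at ibp
  have hle : ∫ x, -(x i * (2 * u x * pd i u x)) ≤ ∫ x, (1 / 2 * u x ^ 2 + 2 * L ^ 2 * ‖fderiv ℝ u x‖ ^ 2) := by
    refine integral_mono (h.integ (by fun_prop) fun x hx => by rw [u0 x hx]; ring)
      ((h.iu2.const_mul _).add (h.iD.const_mul _)) fun x => ?_
    simp only
    by_cases hx : x ∈ W
    · have hx1 : |x i| ≤ L := by
        have h1 : ‖x‖ < L := by simpa using hW hx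
        have h2 := PiLp.norm_apply_le x i
        rw [Real.norm_eq_abs] at h2
        linarith
      have hp1 : |pd i u x| ≤ ‖fderiv ℝ u x‖ := by
        have := (fderiv ℝ u x).le_opNorm (EuclideanSpace.single i 1)
        simpa [pd] using this
      have h3 : |x i| * |pd i u x| ≤ L * ‖fderiv ℝ u x‖ := by gcongr; exact (abs_nonneg _).trans hx1
      calc -(x i * (2 * u x * pd i u x)) ≤ |x i * (2 * u x * pd i u x)| := neg_le_abs _
        _ = 2 * |u x| * (|x i| * |pd i u x|) := by simp only [abs_mul, abs_two]; ring
        _ ≤ 2 * |u x| * (L * ‖fderiv ℝ u x‖) := by gcongr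
        _ ≤ _ := by nlinarith [sq_nonneg (|u x| - 2 * (L * ‖fderiv ℝ u x‖)), sq_abs (u x)]
    · rw [h.zero hx]
      have : 0 ≤ 2 * L ^ 2 * ‖fderiv ℝ u x‖ ^ 2 := by positivity
      simpa using this
  rw [integral_neg, ibp, neg_neg, integral_add (h.iu2.const_mul _) (h.iD.const_mul _),
    integral_const_mul, integral_const_mul] at hle
  unfold Dir
  linarith

theorem J_lower (h : Adm W u) (hN : 1 ≤ N) {L : ℝ} (hL : 0 < L) (hW : W ⊆ Metric.ball 0 L)
    (hWm : MeasurableSet W) :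
    Dir u ≤ 4 * (JJ u + 4 * L ^ 2 * volume.real W) := by
  have hfin : volume W ≠ ∞ := ne_top_of_le_ne_top measure_ball_lt_top.ne (measure_mono hW)
  have p := h.poincare hN hW
  have : ∫ x, u x ≤ ∫ x, (1 / (16 * L ^ 2) * u x ^ 2 + W.indicator (fun _ => 4 * L ^ 2) x) := by
    have iW : Integrable (W.indicator fun _ : Eu N => 4 * L ^ 2) :=
      (integrable_indicator_iff hWm).2 (integrableOn_const hfin)
    refine integral_mono h.iu ((h.iu2.const_mul _).add iW) fun x => ?_
    simp only
    by_cases hx : x ∈ W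
    · rw [Set.indicator_of_mem hx]
      have : 1 / (16 * L ^ 2) * u x ^ 2 + 4 * L ^ 2 - u x = (u x - 8 * L ^ 2) ^ 2 / (16 * L ^ 2) := by
        field_simp; ring
      have h2 : 0 ≤ (u x - 8 * L ^ 2) ^ 2 / (16 * L ^ 2) := by positivity
      linarith
    · rw [Set.indicator_of_notMem hx, h.zero hx]; norm_num
  rw [integral_add (h.iu2.const_mul _) ((integrable_indicator_iff hWm).2 (integrableOn_const hfin)),
    integral_const_mul, integral_indicator hWm, setIntegral_const, smul_eq_mul] at this
  have h3 : 1 / (16 * L ^ 2) * (∫ x, u x ^ 2) ≤ 1 / (16 * L ^ 2) * (4 * L ^ 2 * Dir u) := by gcongr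
  have h4 : 1 / (16 * L ^ 2) * (4 * L ^ 2 * Dir u) = Dir u / 4 := by field_simp; ring
  unfold JJ
  linarith

theorem add_smul (h : Adm W u) (hq : Adm W q) (t : ℝ) : Adm W (fun x => u x + t * q x) := by
  have hz : ∀ x, x ∉ tsupport u ∪ tsupport q → u x + t * q x = 0 := fun x hx => by
    rw [u0 x fun h => hx (.inl h), u0 x fun h => hx (.inr h)]; ring
  have hs : tsupport (fun x => u x + t * q x) ⊆ tsupport u ∪ tsupport q := by
    refine closure_minimal (fun x hx => ?_) ((isClosed_tsupport u).union (isClosed_tsupport q))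
    by_contra hcon
    exact hx (hz x hcon)
  exact ⟨h.smooth.add (contDiff_const.mul hq.smooth),
    HasCompactSupport.intro (h.cpt.isCompact.union hq.cpt.isCompact) hz,
    hs.trans (Set.union_subset h.sub hq.sub)⟩

theorem J_expand (h : Adm W u) (hq : Adm W q) (t : ℝ) :
    JJ (fun x => u x + t * q x) = JJ u + t * ((∫ x, ip u q x) - ∫ x, q x) + t ^ 2 / 2 * Dir q := by
  have hp : ∀ i x, pd i (fun x => u x + t * q x) x = pd i u x + t * pd i q x := fun i x => by
    have := (h.diff x).hasFDerivAt.add ((hq.diff x).hasFDerivAt.const_mul t)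
    unfold pd
    rw [HasFDerivAt.fderiv (f := fun x => u x + t * q x) this]
    simp
  have hn : ∀ x, ‖fderiv ℝ (fun x => u x + t * q x) x‖ ^ 2 =
      ‖fderiv ℝ u x‖ ^ 2 + (2 * t) * ip u q x + t ^ 2 * ‖fderiv ℝ q x‖ ^ 2 := fun x => by
    simp only [norm_fderiv_sq, hp, ip, Finset.mul_sum, ← Finset.sum_add_distrib]
    exact Finset.sum_congr rfl fun i _ => by ring
  unfold JJ Dir
  have i1 : Integrable fun x => ‖fderiv ℝ u x‖ ^ 2 + (2 * t) * ip u q x := h.iD.add ((h.iip hq).const_mul _)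
  simp only [hn]
  rw [integral_add i1 (hq.iD.const_mul _), integral_add h.iD ((h.iip hq).const_mul _),
    integral_add h.iu (hq.iu.const_mul _), integral_const_mul, integral_const_mul, integral_const_mul]
  ring

theorem variation (h : Adm W u) (hq : Adm W q) {m ε : ℝ} (hm : ∀ w, Adm W w → m ≤ JJ w)
    (hu : JJ u ≤ m + ε) : ((∫ x, ip u q x) - ∫ x, q x) ^ 2 ≤ 2 * ε * Dir q := by
  have := discrim_le_zero (a := Dir q / 2) (b := (∫ x, ip u q x) - ∫ x, q x) (c := ε) (fun t => by
    have h1 := hm _ (h.add_smul hq t)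
    rw [h.J_expand hq t] at h1
    nlinarith)
  unfold discrim at this
  linarith

/-- composition with a scalar function -/
theorem comp (h : Adm W u) {φ : ℝ → ℝ} (h0 : φ 0 = 0) (hφ : ContDiff ℝ 1 (fun x => φ (u x))) :
    Adm W (fun x => φ (u x)) := by
  have hz : ∀ x, x ∉ tsupport u → φ (u x) = 0 := fun x hx => by rw [u0 x hx, h0]
  have hs : tsupport (fun x => φ (u x)) ⊆ tsupport u := by
    refine closure_minimal (fun x hx => ?_) (isClosed_tsupport u)
    by_contra hcon
    exact hx (hz x hcon)
  exact ⟨hφ, HasCompactSupport.intro h.cpt.isCompact hz, hs.trans h.sub⟩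

theorem comp_fderiv (h : Adm W u) {φ : ℝ → ℝ} {d : ℝ} {x : Eu N} (hφ : HasDerivAt φ d (u x)) :
    fderiv ℝ (fun x => φ (u x)) x = d • fderiv ℝ u x := 
  HasFDerivAt.fderiv (f := fun x => φ (u x)) (hφ.comp_hasFDerivAt x (h.diff x).hasFDerivAt)

end Adm

namespace Adm
variable {N : ℕ} {W : Set (Eu N)} {u q : Eu N → ℝ}

theorem nonneg_red (h : Adm W u) (hWm : MeasurableSet W) (hfin : volume W ≠ ∞) {δ : ℝ} (hδ : 0 < δ) :
    ∃ w, Adm W w ∧ (∀ x, 0 ≤ w x) ∧ JJ w ≤ JJ u + δ * volume.real W := by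
  set χ : ℝ → ℝ := fun t => min 1 (max (t / δ) 0) with hχ
  have cχ : Continuous χ := by fun_prop
  have χ0 : ∀ t, 0 ≤ χ t := fun t => le_min zero_le_one (le_max_right _ _)
  have χ1 : ∀ t, χ t ≤ 1 := fun t => min_le_left _ _
  have χn : ∀ t, t ≤ 0 → χ t = 0 := fun t ht => by
    have : t / δ ≤ 0 := div_nonpos_of_nonpos_of_nonneg ht hδ.le
    simp [hχ, max_eq_right this]
  have χp : ∀ t, δ ≤ t → χ t = 1 := fun t ht => by
    have : 1 ≤ t / δ := by rwa [le_div_iff₀ hδ, one_mul]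
    simp only [hχ]; exact min_eq_left (this.trans (le_max_left _ _))
  set φ : ℝ → ℝ := fun s => ∫ t in (0:ℝ)..s, χ t with hφ
  have dφ : ∀ s, HasDerivAt φ (χ s) s := fun s => (cχ.integral_hasStrictDerivAt 0 s).hasDerivAt
  have φ0 : φ 0 = 0 := by simp [hφ]
  have φs : ContDiff ℝ 1 φ := by
    rw [contDiff_one_iff_deriv]
    refine ⟨fun s => (dφ s).differentiableAt, ?_⟩
    have : deriv φ = χ := funext fun s => (dφ s).deriv
    rw [this]; exact cχ
  have mono : Monotone φ := monotone_of_hasDerivAt_nonneg dφ (fun s => χ0 s)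
  have φn : ∀ s, s ≤ 0 → φ s = 0 := fun s hs => by
    have : ∫ t in (0:ℝ)..s, χ t = ∫ t in (0:ℝ)..s, (0:ℝ) := by
      refine intervalIntegral.integral_congr fun t ht => ?_
      rw [Set.uIcc_of_ge hs] at ht
      exact χn t ht.2
    simpa using this
  have φnn : ∀ s, 0 ≤ φ s := fun s => by
    rcases le_total s 0 with hs | hs
    · rw [φn s hs]
    · rw [← φ0]; exact mono hs
  have φl : ∀ s, s - δ ≤ φ s := fun s => by
    rcases le_total s δ with hs | hs
    · linarith [φnn s]
    · have e : φ s = φ δ + ∫ t in δ..s, χ t := by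
        simp only [hφ]
        rw [intervalIntegral.integral_add_adjacent_intervals (cχ.intervalIntegrable _ _) (cχ.intervalIntegrable _ _)]
      have e2 : ∫ t in δ..s, χ t = ∫ t in δ..s, (1:ℝ) := by
        refine intervalIntegral.integral_congr fun t ht => ?_
        rw [Set.uIcc_of_le hs] at ht
        exact χp t ht.1
      rw [e, e2]
      simp
      exact φnn δ
  have hw : Adm W (fun x => φ (u x)) := h.comp φ0 (φs.comp h.smooth)
  refine ⟨_, hw, fun x => φnn _, ?_⟩
  have hD : Dir (fun x => φ (u x)) ≤ Dir u := by
    refine integral_mono hw.iD h.iD fun x => ?_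
    simp only
    rw [h.comp_fderiv (dφ (u x)), norm_smul, mul_pow, Real.norm_of_nonneg (χ0 _)]
    have : χ (u x) ^ 2 ≤ 1 := pow_le_one₀ (χ0 _) (χ1 _)
    nlinarith [sq_nonneg ‖fderiv ℝ u x‖]
  have iW : Integrable (W.indicator fun _ : Eu N => δ) :=
      (integrable_indicator_iff hWm).2 (integrableOn_const hfin)
  have hI : ∫ x, u x ≤ ∫ x, (φ (u x) + W.indicator (fun _ => δ) x) := by
    refine integral_mono h.iu (hw.iu.add iW) fun x => ?_
    simp only
    by_cases hx : x ∈ W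
    · rw [Set.indicator_of_mem hx]; linarith [φl (u x)]
    · rw [Set.indicator_of_notMem hx, h.zero hx, φ0]; norm_num
  rw [integral_add hw.iu iW, integral_indicator hWm, setIntegral_const, smul_eq_mul] at hI
  unfold JJ
  linarith

theorem trunc (h : Adm W u) (h0 : ∀ x, 0 ≤ u x) {m ε M : ℝ} (hM : 0 < M) (hm : ∀ w, Adm W w → m ≤ JJ w)
    (hu : JJ u ≤ m + ε) (hε : 0 ≤ ε) : ∃ z, Adm W z ∧ (∀ x, 0 ≤ z x) ∧ (∀ x, 0 ≤ u x - z x) ∧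
      (∀ x, u x - z x ≤ u x ^ 2 / M) ∧
      2 * ∫ x, z x * ‖fderiv ℝ z x‖ ^ 2 ≤ (∫ x, z x ^ 2) + √(8 * ε * M ^ 2 * Dir u) := by
  set φ : ℝ → ℝ := fun s => M * s / (M + s) with hφ
  have pos : ∀ x, 0 < M + u x := fun x => by linarith [h0 x]
  have hd : ∀ x, HasDerivAt φ (M ^ 2 / (M + u x) ^ 2) (u x) := fun x => by
    have h1 : HasDerivAt (fun s : ℝ => M * s) M (u x) := by
      simpa using (hasDerivAt_id (u x)).const_mul M
    have h2 : HasDerivAt (fun s : ℝ => M + s) 1 (u x) := by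
      simpa using (hasDerivAt_id (u x)).const_add M
    have := h1.div h2 (pos x).ne'
    exact this.congr_deriv (by ring)
  have hz : Adm W (fun x => φ (u x)) := h.comp (by simp [hφ])
    ((contDiff_const.mul h.smooth).div (contDiff_const.add h.smooth) fun x => (pos x).ne')
  have d0 : ∀ x, 0 ≤ M ^ 2 / (M + u x) ^ 2 := fun x => by positivity
  have d1 : ∀ x, M ^ 2 / (M + u x) ^ 2 ≤ 1 := fun x => by
    rw [div_le_one (by have := pos x; positivity)]
    have := h0 x
    gcongr; linarith
  have z0 : ∀ x, 0 ≤ φ (u x) := fun x => div_nonneg (mul_nonneg hM.le (h0 x)) (pos x).le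
  have zM : ∀ x, φ (u x) ≤ M := fun x => by
    simp only [hφ]; rw [div_le_iff₀ (pos x)]; nlinarith
  have hs : ∀ x, u x - φ (u x) = u x ^ 2 / (M + u x) := fun x => by
    have := (pos x).ne'
    simp only [hφ]; field_simp; ring
  have hfd : ∀ x, fderiv ℝ (fun x => φ (u x)) x = (M ^ 2 / (M + u x) ^ 2) • fderiv ℝ u x := fun x =>
    h.comp_fderiv (hd x)
  have hq : Adm W (fun x => φ (u x) ^ 2) := h.comp (φ := fun s => φ s ^ 2) (by simp [hφ]) (hz.smooth.pow 2)
  have hqf : ∀ x, fderiv ℝ (fun x => φ (u x) ^ 2) x =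
      (2 * φ (u x) * (M ^ 2 / (M + u x) ^ 2)) • fderiv ℝ u x := fun x => by
    refine h.comp_fderiv (φ := fun s => φ s ^ 2) ?_
    have h2 : HasDerivAt (fun s : ℝ => s ^ 2) (2 * φ (u x)) (φ (u x)) := by
      simpa using hasDerivAt_pow 2 (φ (u x))
    exact h2.comp (u x) (hd x)
  refine ⟨_, hz, z0, fun x => ?_, fun x => ?_, ?_⟩
  · rw [hs]; have := pos x; positivity
  · rw [hs]; have := h0 x; gcongr; linarith
  have hip : ∀ x, ip u (fun x => φ (u x) ^ 2) x = 2 * φ (u x) * (M ^ 2 / (M + u x) ^ 2) * ‖fderiv ℝ u x‖ ^ 2 := by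
    intro x
    rw [norm_fderiv_sq, ip, Finset.mul_sum]
    refine Finset.sum_congr rfl fun i _ => ?_
    rw [pd, pd, hqf]
    simp; ring
  have hDq : Dir (fun x => φ (u x) ^ 2) ≤ 4 * M ^ 2 * Dir u := by
    unfold Dir
    rw [← integral_const_mul]
    refine integral_mono hq.iD (h.iD.const_mul _) fun x => ?_
    simp only
    rw [hqf, norm_smul, mul_pow, Real.norm_of_nonneg (by have := z0 x; have := d0 x; positivity)]
    have : 2 * φ (u x) * (M ^ 2 / (M + u x) ^ 2) ≤ 2 * M * 1 := by
      have := z0 x; have := zM x; have := d0 x; have := d1 x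
      gcongr
    have h3 : (2 * φ (u x) * (M ^ 2 / (M + u x) ^ 2)) ^ 2 ≤ (2 * M * 1) ^ 2 := by
      have := z0 x; have := d0 x
      gcongr
    have h4 : (2 * M * 1) ^ 2 = 4 * M ^ 2 := by ring
    rw [h4] at h3
    gcongr
  have hv := h.variation hq hm hu
  have h5 : (∫ x, ip u (fun x => φ (u x) ^ 2) x) - ∫ x, φ (u x) ^ 2 ≤ √(8 * ε * M ^ 2 * Dir u) := by
    apply Real.le_sqrt_of_sq_le
    refine hv.trans ?_
    calc 2 * ε * Dir (fun x => φ (u x) ^ 2) ≤ 2 * ε * (4 * M ^ 2 * Dir u) := by gcongr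
      _ = _ := by ring
  have h6 : 2 * ∫ x, φ (u x) * ‖fderiv ℝ (fun x => φ (u x)) x‖ ^ 2 ≤ ∫ x, ip u (fun x => φ (u x) ^ 2) x := by
    rw [← integral_const_mul]
    refine integral_mono (Integrable.const_mul (hz.integ (hz.cont.mul (hz.cfd.norm.pow 2)) fun x hx => ?_) _)
      (h.iip hq) fun x => ?_
    · show φ (u x) * _ = 0
      have := u0 x hx
      rw [this, zero_mul]
    · simp only
      rw [hip, hfd, norm_smul, mul_pow, Real.norm_of_nonneg (d0 x)]
      have h1 := z0 x
      have : (M ^ 2 / (M + u x) ^ 2) ^ 2 ≤ M ^ 2 / (M + u x) ^ 2 := by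
        have := d0 x; have := d1 x; nlinarith
      calc 2 * (φ (u x) * ((M ^ 2 / (M + u x) ^ 2) ^ 2 * ‖fderiv ℝ u x‖ ^ 2))
          ≤ 2 * (φ (u x) * ((M ^ 2 / (M + u x) ^ 2) * ‖fderiv ℝ u x‖ ^ 2)) := by gcongr
        _ = _ := by ring
  linarith

end Adm
section Green
variable {N : ℕ} {v : Eu N → ℝ}

theorem lap_eq (v : Eu N → ℝ) (x : Eu N) : laplacian v x = ∑ i, pd i (pd i v) x := rfl

theorem pd_smooth (hv : ContDiff ℝ (⊤ : ℕ∞) v) (i : Fin N) : ContDiff ℝ (⊤ : ℕ∞) (pd i v) := by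
  have h := hv.fderiv_right (m := (⊤ : ℕ∞)) (by simp)
  exact h.clm_apply contDiff_const

theorem pd_adm (hv : ContDiff ℝ (⊤ : ℕ∞) v) (hc : HasCompactSupport v) (i : Fin N) :
    Adm (tsupport v) (pd i v) := by
  have hz : ∀ x, x ∉ tsupport v → pd i v x = 0 := fun x hx => Adm.p0 i x hx
  refine ⟨(pd_smooth hv i).of_le (by norm_cast), HasCompactSupport.intro hc.isCompact hz, ?_⟩
  refine closure_minimal (fun x hx => ?_) (isClosed_tsupport v)
  by_contra hcon
  exact hx (hz x hcon)

theorem lap_cont (hv : ContDiff ℝ (⊤ : ℕ∞) v) : Continuous (laplacian v) := by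
  have : laplacian v = fun x => ∑ i, pd i (pd i v) x := funext (lap_eq v)
  rw [this]
  exact continuous_finsetSum _ fun i _ => (pd_smooth (pd_smooth hv i) i).continuous

theorem lap_zero (hv : ContDiff ℝ (⊤ : ℕ∞) v) (hc : HasCompactSupport v) {x : Eu N} (hx : x ∉ tsupport v) :
    laplacian v x = 0 := by
  rw [lap_eq]
  refine Finset.sum_eq_zero fun i _ => ?_
  rw [pd, (pd_adm hv hc i).fzero hx]; simp

theorem green (hv : ContDiff ℝ (⊤ : ℕ∞) v) (hc : HasCompactSupport v) {u : Eu N → ℝ} (hu : ContDiff ℝ 1 u) :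
    ∫ x, ip u v x = - ∫ x, u x * laplacian v x := by
  have cu := hu.continuous
  have cpu : ∀ i, Continuous (pd i u) := fun i => by
    have := hu.continuous_fderiv one_ne_zero
    unfold pd; fun_prop
  have key : ∀ i, ∫ x, u x * pd i (pd i v) x = - ∫ x, pd i u x * pd i v x := fun i => by
    have ha := pd_adm hv hc i
    refine integral_mul_fderiv_eq_neg_fderiv_mul_of_integrable (μ := (volume : Measure (Eu N)))
      (f := u) (g := pd i v) (v := EuclideanSpace.single i 1) ?_ ?_ ?_ ?_ ?_
    · exact ha.integ ((cpu i).mul ha.cont) fun x hx => by rw [Adm.u0 x hx, mul_zero]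
    · exact ha.integ (cu.mul (ha.cpd i)) fun x hx => by rw [Adm.f0 x hx]; simp
    · exact ha.integ (cu.mul ha.cont) fun x hx => by rw [Adm.u0 x hx, mul_zero]
    · exact fun x _ => hu.differentiable one_ne_zero x
    · exact fun x _ => ha.diff x
  simp only [lap_eq, ip, Finset.mul_sum]
  rw [integral_finsetSum, integral_finsetSum, ← Finset.sum_neg_distrib]
  · exact Finset.sum_congr rfl fun i _ => by rw [key i, neg_neg]
  · intro i _
    have ha := pd_adm hv hc i
    exact ha.integ (cu.mul (ha.cpd i)) fun x hx => by rw [Adm.p0 i x hx, mul_zero]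
  · intro i _
    have ha := pd_adm hv hc i
    exact ha.integ ((cpu i).mul ha.cont) fun x hx => by rw [Adm.u0 x hx, mul_zero]

theorem lap_int (hv : ContDiff ℝ (⊤ : ℕ∞) v) (hc : HasCompactSupport v) : ∫ x, laplacian v x = 0 := by
  have := green hv hc (u := fun _ => 1) contDiff_const
  simpa [ip, pd] using this

end Green

theorem int_add6 {N : ℕ} {f₁ f₂ f₃ f₄ f₅ f₆ : Eu N → ℝ} (h₁ : Integrable f₁) (h₂ : Integrable f₂)
    (h₃ : Integrable f₃) (h₄ : Integrable f₄) (h₅ : Integrable f₅) (h₆ : Integrable f₆) :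
    ∫ x, (f₁ x + f₂ x + f₃ x + f₄ x + f₅ x + f₆ x) = (∫ x, f₁ x) + (∫ x, f₂ x) + (∫ x, f₃ x) + (∫ x, f₄ x)
      + (∫ x, f₅ x) + (∫ x, f₆ x) := by
  have g₂ : Integrable fun x => f₁ x + f₂ x := h₁.add h₂
  have g₃ : Integrable fun x => f₁ x + f₂ x + f₃ x := g₂.add h₃
  have g₄ : Integrable fun x => f₁ x + f₂ x + f₃ x + f₄ x := g₃.add h₄
  have g₅ : Integrable fun x => f₁ x + f₂ x + f₃ x + f₄ x + f₅ x := g₄.add h₅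
  rw [integral_add g₅ h₆, integral_add g₄ h₅, integral_add g₃ h₄, integral_add g₂ h₃, integral_add h₁ h₂]

set_option maxHeartbeats 1000000 in
/-- Fourth-order Saint-Venant inequality in Euclidean space: for any open set
`Ω ⊆ ℝ^N` whose volume equals that of a ball of radius `R`, and any smooth
compactly supported `v` with support in `Ω`, the clamped-plate energy
`(1/2)∫(Δv)² − ∫v` is at least `−ω_{N−1} R^{N+4}/(2N²(N+2)²(N+4))`,
where `ω_{N−1} = N · volume(unit ball)` is the area of the unit sphere. -/
theorem stmt_0 (N : ℕ) (hN : 1 ≤ N) (R : ℝ) (hR : 0 < R)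
    (Ω : Set (EuclideanSpace ℝ (Fin N))) (hΩ : IsOpen Ω)
    (hvol : volume Ω = volume (Metric.ball (0 : EuclideanSpace ℝ (Fin N)) R))
    (v : EuclideanSpace ℝ (Fin N) → ℝ)
    (hv : ContDiff ℝ (⊤ : ℕ∞) v) (hsupp : HasCompactSupport v) (hsub : tsupport v ⊆ Ω) :
    (1/2) * (∫ x, (laplacian v x)^2) - ∫ x, v x ≥
      -(((N : ℝ) * (volume (Metric.ball (0 : EuclideanSpace ℝ (Fin N)) 1)).toReal)
          * R^(N+4)) / (2 * (N:ℝ)^2 * ((N:ℝ)+2)^2 * ((N:ℝ)+4)) := by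
  have hN' : (0:ℝ) < N := by exact_mod_cast hN
  have : Nonempty (Fin N) := ⟨⟨0, hN⟩⟩
  obtain ⟨κ, hκ⟩ : ∃ κ, κ = (volume (Metric.ball (0 : EuclideanSpace ℝ (Fin N)) 1)).toReal := ⟨_, rfl⟩
  rw [← hκ]
  have κpos : 0 < κ := by
    rw [hκ]
    exact ENNReal.toReal_pos (Metric.measure_ball_pos _ _ one_pos).ne' measure_ball_lt_top.ne
  have Vfin : volume Ω ≠ ∞ := by rw [hvol]; exact measure_ball_lt_top.ne
  have hV : volume.real Ω = κ * R ^ N := by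
    rw [Measure.real, hvol, Measure.addHaar_ball _ _ hR.le, finrank_euclideanSpace_fin, ENNReal.toReal_mul,
      ENNReal.toReal_ofReal (by positivity), hκ, mul_comm]
  obtain ⟨V, hVd⟩ : ∃ V, V = κ * R ^ N := ⟨_, rfl⟩
  have Vpos : 0 < V := by rw [hVd]; positivity
  -- the bounded set
  obtain ⟨L, hL, hLs⟩ : ∃ L : ℝ, 0 < L ∧ tsupport v ⊆ Metric.ball 0 L := by
    obtain ⟨L, hL⟩ := hsupp.isCompact.isBounded.subset_ball (0 : EuclideanSpace ℝ (Fin N))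
    exact ⟨max L 1, by positivity, hL.trans (Metric.ball_subset_ball (le_max_left _ _))⟩
  obtain ⟨W, hW⟩ : ∃ W : Set (Eu N), W = Ω ∩ Metric.ball 0 L := ⟨_, rfl⟩
  have hWΩ : W ⊆ Ω := hW ▸ Set.inter_subset_left
  have hWL : W ⊆ Metric.ball 0 L := hW ▸ Set.inter_subset_right
  have hWm : MeasurableSet W := by rw [hW]; exact (hΩ.inter Metric.isOpen_ball).measurableSet
  have hWfin : volume W ≠ ∞ := ne_top_of_le_ne_top Vfin (measure_mono hWΩ)
  have av : Adm W v := ⟨hv.of_le (by norm_cast), hsupp, by rw [hW]; exact Set.subset_inter hsub hLs⟩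
  -- infimum
  have hDnn : ∀ w : Eu N → ℝ, 0 ≤ Dir w := fun w => integral_nonneg fun x => by positivity
  obtain ⟨S, hS⟩ : ∃ S : Set ℝ, S = {r | ∃ w, Adm W w ∧ JJ w = r} := ⟨_, rfl⟩
  have Sb : BddBelow S := by
    refine ⟨-(4 * L ^ 2 * volume.real W), ?_⟩
    rw [hS]
    rintro r ⟨w, hw, rfl⟩
    have := hw.J_lower hN hL hWL hWm
    linarith [hDnn w]
  have a0 : Adm W (fun _ : Eu N => (0:ℝ)) :=
    ⟨contDiff_const, HasCompactSupport.intro isCompact_empty (fun x _ => rfl), by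
      have : tsupport (fun _ : Eu N => (0:ℝ)) = ∅ := by
        rw [tsupport_eq_empty_iff]; rfl
      rw [this]; exact Set.empty_subset _⟩
  have hJ0 : JJ (fun _ : Eu N => (0:ℝ)) = 0 := by simp [JJ, Dir]
  have Sn : S.Nonempty := ⟨0, by rw [hS]; exact ⟨_, a0, hJ0⟩⟩
  obtain ⟨m, hm⟩ : ∃ m, m = sInf S := ⟨_, rfl⟩
  have hmle : ∀ w, Adm W w → m ≤ JJ w := fun w hw => by
    rw [hm]; exact csInf_le Sb (by rw [hS]; exact ⟨w, hw, rfl⟩)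
  have hm0 : m ≤ 0 := hJ0 ▸ hmle _ a0
  have exu : ∀ ε, 0 < ε → ∃ u, Adm W u ∧ (∀ x, 0 ≤ u x) ∧ JJ u ≤ m + ε := by
    intro ε hε
    obtain ⟨r, hr, hrl⟩ := Real.lt_sInf_add_pos Sn (half_pos hε)
    rw [hS] at hr
    obtain ⟨w, hw, rfl⟩ := hr
    have hp : 0 < volume.real W + 1 := by have : 0 ≤ volume.real W := measureReal_nonneg; linarith
    obtain ⟨u, hu, hu0, huJ⟩ := hw.nonneg_red hWm hWfin (δ := ε / 2 / (volume.real W + 1)) (by positivity)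
    refine ⟨u, hu, hu0, ?_⟩
    have : ε / 2 / (volume.real W + 1) * volume.real W ≤ ε / 2 := by
      rw [div_mul_eq_mul_div, div_le_iff₀ hp]; nlinarith
    rw [← hm] at hrl
    linarith
  -- laplacian facts
  have lc := lap_cont hv
  have lz : ∀ x, x ∉ tsupport v → laplacian v x = 0 := fun x hx => lap_zero hv hsupp hx
  have li : Integrable (laplacian v) := av.integ lc lz
  have li2 : Integrable (fun x => laplacian v x ^ 2) :=
    av.integ (lc.pow 2) fun x hx => by rw [lz x hx]; norm_num
  obtain ⟨s, hs⟩ : ∃ s, ∀ x, ‖laplacian v x‖ ≤ s :=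
    (HasCompactSupport.intro hsupp.isCompact lz).exists_bound_of_continuous lc
  have s0 : 0 ≤ s := (norm_nonneg _).trans (hs 0)
  obtain ⟨D, hD⟩ : ∃ D, D = 4 * (1 + 4 * L ^ 2 * volume.real W) := ⟨_, rfl⟩
  obtain ⟨X, hX⟩ : ∃ X, X = κ * R ^ (N + 4) / (N * (N + 2) ^ 2 * (N + 4)) := ⟨_, rfl⟩
  have main : ∫ x, v x ≤ 1 / 2 * (∫ x, laplacian v x ^ 2) + 1 / 2 * X := by
    refine le_of_small (C := s * (4 * L ^ 2 * D) + √(8 * D) + √(2 * Dir v)) one_pos fun t ht ht1 => ?_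
    obtain ⟨u, hu, hu0, huJ⟩ := exu (t ^ 4) (by positivity)
    have ht4 : t ^ 4 ≤ 1 := pow_le_one₀ ht.le ht1.le
    have hDu : Dir u ≤ D := by
      rw [hD]
      refine (hu.J_lower hN hL hWL hWm).trans ?_
      linarith
    obtain ⟨z, hz, hz0, huz, huz2, hzz⟩ := hu.trunc hu0 (M := 1 / t) (by positivity) hmle huJ (by positivity)
    have he : √(8 * t ^ 4 * (1 / t) ^ 2 * Dir u) ≤ t * √(8 * D) := by
      have : 8 * t ^ 4 * (1 / t) ^ 2 * Dir u = t ^ 2 * (8 * Dir u) := by field_simp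
      rw [this, Real.sqrt_mul (by positivity), Real.sqrt_sq ht.le]
      gcongr
    have hvb := var_bound hN hz.smooth hz.cpt hz0 (e := t * √(8 * D)) (by positivity) hR hκ (by linarith)
    rw [← hVd, ← hX] at hvb
    have hvar := hu.variation av hmle huJ
    have h1 : ∫ x, v x ≤ (∫ x, ip u v x) + t * √(2 * Dir v) := by
      have : (∫ x, v x) - (∫ x, ip u v x) ≤ √(2 * t ^ 4 * Dir v) := by
        apply Real.le_sqrt_of_sq_le
        nlinarith
      have e : 2 * t ^ 4 * Dir v = (t ^ 2) ^ 2 * (2 * Dir v) := by ring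
      rw [e, Real.sqrt_mul (by positivity), Real.sqrt_sq (by positivity)] at this
      have : t ^ 2 * √(2 * Dir v) ≤ t * √(2 * Dir v) := by
        gcongr; nlinarith
      linarith
    rw [green hv hsupp hu.smooth] at h1
    obtain ⟨c, hc⟩ : ∃ c, c = (∫ x, z x) / V := ⟨_, rfl⟩
    have iΩ : Integrable (Ω.indicator fun _ : Eu N => c ^ 2) :=
      (integrable_indicator_iff hΩ.measurableSet).2 (integrableOn_const Vfin)
    have h2 : ∫ x, -(u x * laplacian v x) ≤
        ∫ x, (((((s * t) * u x ^ 2 + 1 / 2 * laplacian v x ^ 2) + 1 / 2 * z x ^ 2) + (-c) * z x)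
          + 1 / 2 * Ω.indicator (fun _ => c ^ 2) x) + (-c) * laplacian v x := by
      refine integral_mono (Integrable.neg (hu.integ (hu.cont.mul lc) fun x hx => ?_))
        ((((((hu.iu2.const_mul _).add (li2.const_mul _)).add (hz.iu2.const_mul _)).add (hz.iu.const_mul _)).add
          (iΩ.const_mul _)).add (li.const_mul _)) fun x => ?_
      · show u x * _ = 0
        rw [Adm.u0 x hx, zero_mul]
      · simp only
        by_cases hx : x ∈ Ω
        · rw [Set.indicator_of_mem hx]
          have h3 : -laplacian v x ≤ s := (neg_le_abs _).trans (hs x)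
          have h4 := huz2 x
          have h5 : u x ^ 2 / (1 / t) = t * u x ^ 2 := by field_simp
          rw [h5] at h4
          have h6 : (u x - z x) * (-laplacian v x) ≤ (t * u x ^ 2) * s :=
            (mul_le_mul_of_nonneg_left h3 (huz x)).trans (mul_le_mul_of_nonneg_right h4 s0)
          nlinarith [sq_nonneg (z x - c + laplacian v x)]
        · rw [Set.indicator_of_notMem hx, lz x (fun h => hx (hsub h)), hu.zero fun h => hx (hWΩ h),
            hz.zero fun h => hx (hWΩ h)]
          norm_num
    rw [int_add6 (hu.iu2.const_mul _) (li2.const_mul _) (hz.iu2.const_mul _) (hz.iu.const_mul _) (iΩ.const_mul _)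
      (li.const_mul _)] at h2
    simp only [integral_const_mul] at h2
    rw [integral_indicator hΩ.measurableSet, setIntegral_const, smul_eq_mul, hV, ← hVd, lap_int hv hsupp,
      integral_neg] at h2
    have h7 : (-c) * (∫ x, z x) + 1 / 2 * (V * c ^ 2) = - (1 / 2) * ((∫ x, z x) ^ 2 / V) := by
      rw [hc]; field_simp; ring
    have h8 : s * t * ∫ x, u x ^ 2 ≤ s * t * (4 * L ^ 2 * D) := by
      have := hu.poincare hN hWL
      have h9 : 4 * L ^ 2 * Dir u ≤ 4 * L ^ 2 * D := by gcongr
      have := this.trans h9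
      gcongr
    linarith
  have hfin : -((N : ℝ) * κ * R^(N+4)) / (2 * (N:ℝ)^2 * ((N:ℝ)+2)^2 * ((N:ℝ)+4)) = -(1 / 2 * X) := by
    rw [hX]; field_simp
  rw [hfin]
  linarith
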